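/- (Decomposition of the energy functional and of its derivative) Assume (h1), (h3) and let f satisfy (f1), (f2). Then for every u ∈ X: J(u) = J(u⁺) + J(u⁻) − ∬_{ℝ^N×ℝ^N} (u⁺(x)u⁻(y) + u⁻(x)u⁺(y))/|x−y|^{N+2α} dx dy, and ⟨J'(u), u⁺⟩ = ⟨J'(u⁺), u⁺⟩ − ∬_{ℝ^N×ℝ^N} (u⁺(x)u⁻(y) + u⁻(x)u⁺(y))/|x−y|^{N+2α} dx dy. -/

import Mathlib

open MeasureTheory Filter

noncomputable section

namespace ZeroMass

/-- The ambient Euclidean space `ℝ^N`. -/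
abbrev EN (N : ℕ) := EuclideanSpace ℝ (Fin N)

/-- The critical fractional Sobolev exponent `2*_α = 2N/(N-2α)`. -/
def critExp (N : ℕ) (α : ℝ) : ℝ := 2 * N / (N - 2 * α)

/-- The square of the Gagliardo seminorm `[u]²`. -/
def gagSq (N : ℕ) (α : ℝ) (u : EN N → ℝ) : ENNReal :=
  ∫⁻ p : EN N × EN N, ENNReal.ofReal ((u p.1 - u p.2) ^ 2 / ‖p.1 - p.2‖ ^ ((N : ℝ) + 2 * α))

/-- The square of the full norm `‖u‖² = [u]² + ∫ V u²`. -/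
def normSq {N : ℕ} (α : ℝ) (V : EN N → ℝ) (u : EN N → ℝ) : ENNReal :=
  gagSq N α u + ∫⁻ x, ENNReal.ofReal (V x * u x ^ 2)

/-- Membership in the space `X`. -/
def memX {N : ℕ} (α : ℝ) (V : EN N → ℝ) (u : EN N → ℝ) : Prop :=
  Measurable u ∧ normSq α V u < ⊤

/-- The norm of `X`, i.e. `‖u‖ = ([u]² + ∫ V u²)^{1/2}`. -/
def Xnorm {N : ℕ} (α : ℝ) (V : EN N → ℝ) (u : EN N → ℝ) : ℝ :=
  ((normSq α V u).toReal) ^ (1 / 2 : ℝ)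

/-- The primitive `F(t) = ∫₀ᵗ f(τ) dτ`. -/
def prim (f : ℝ → ℝ) (t : ℝ) : ℝ := ∫ τ in (0 : ℝ)..t, f τ

/-- The energy functional `J`. -/
def Jfun {N : ℕ} (α : ℝ) (V K : EN N → ℝ) (f : ℝ → ℝ) (u : EN N → ℝ) : ℝ :=
  (1 / 2) * (normSq α V u).toReal - ∫ x, K x * prim f (u x)

/-- The pairing `⟨J'(u), φ⟩`. -/
def Jd {N : ℕ} (α : ℝ) (V K : EN N → ℝ) (f : ℝ → ℝ) (u φ : EN N → ℝ) : ℝ :=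
  (∫ p : EN N × EN N, (u p.1 - u p.2) * (φ p.1 - φ p.2) / ‖p.1 - p.2‖ ^ ((N : ℝ) + 2 * α))
    + (∫ x, V x * u x * φ x) - ∫ x, K x * f (u x) * φ x

/-- Positive part `u⁺ = max(u, 0)`. -/
def uplus {N : ℕ} (u : EN N → ℝ) : EN N → ℝ := fun x => max (u x) 0

/-- Negative part `u⁻ = min(u, 0)`. -/
def uminus {N : ℕ} (u : EN N → ℝ) : EN N → ℝ := fun x => min (u x) 0

/-- `u` is not almost everywhere zero. -/
def NotAEZero {N : ℕ} (u : EN N → ℝ) : Prop :=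
  ¬ (u =ᵐ[(volume : Measure (EN N))] (0 : EN N → ℝ))

/-- Hypothesis (h1): `V, K > 0` everywhere and `K` bounded. -/
def H1 {N : ℕ} (V K : EN N → ℝ) : Prop :=
  (∀ x, 0 < V x) ∧ (∀ x, 0 < K x) ∧ ∃ C : ℝ, ∀ x, K x ≤ C

/-- Hypothesis (h2): uniform vanishing of `∫_{A_n ∩ {|x| ≥ r}} K`. -/
def H2 {N : ℕ} (K : EN N → ℝ) : Prop :=
  ∀ (A : ℕ → Set (EN N)) (R : ℝ), 0 < R → (∀ n, MeasurableSet (A n)) →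
    (∀ n, volume (A n) ≤ ENNReal.ofReal R) →
    ∀ ε : ℝ, 0 < ε → ∃ r₀ : ℝ, ∀ r : ℝ, r₀ ≤ r → ∀ n,
      (∫⁻ x in A n ∩ {x : EN N | r ≤ ‖x‖}, ENNReal.ofReal (K x)) ≤ ENNReal.ofReal ε

/-- Hypothesis (h3): `K/V` is bounded. -/
def H3 {N : ℕ} (V K : EN N → ℝ) : Prop := ∃ C : ℝ, ∀ x, K x / V x ≤ C

/-- Hypothesis (h4) with exponent `m`. -/
def H4 {N : ℕ} (α : ℝ) (V K : EN N → ℝ) (m : ℝ) : Prop :=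
  2 < m ∧ m < critExp N α ∧
    Tendsto (fun x : EN N => K x / V x ^ ((critExp N α - m) / (critExp N α - 2)))
      (comap (fun x : EN N => ‖x‖) atTop) (nhds 0)

/-- Hypothesis (f1): `f(t)/|t| → 0` as `t → 0`. -/
def Cf1 (f : ℝ → ℝ) : Prop :=
  Tendsto (fun t : ℝ => f t / |t|) (nhdsWithin 0 {(0 : ℝ)}ᶜ) (nhds 0)

/-- Hypothesis (f̃1): `limsup_{t→0} f(t)/|t|^{m-1} < ∞`. -/
def Cf1' (f : ℝ → ℝ) (m : ℝ) : Prop :=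
  ∃ C : ℝ, ∀ᶠ t in nhdsWithin (0 : ℝ) {(0 : ℝ)}ᶜ, f t / |t| ^ (m - 1) ≤ C

/-- Hypothesis (f2) with exponent `p`: `f(t)/|t|^{p-1} → 0` as `|t| → ∞`. -/
def Cf2 (f : ℝ → ℝ) (p : ℝ) : Prop :=
  Tendsto (fun t : ℝ => f t / |t| ^ (p - 1)) (comap (fun t : ℝ => |t|) atTop) (nhds 0)

/-- Hypothesis (f3): `F(t)/t² → +∞` as `|t| → ∞`. -/
def Cf3 (f : ℝ → ℝ) : Prop :=
  Tendsto (fun t : ℝ => prim f t / t ^ 2) (comap (fun t : ℝ => |t|) atTop) atTop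

/-- Hypothesis (f4): `t ↦ f(t)/|t|` is strictly increasing on `ℝ \ {0}`. -/
def Cf4 (f : ℝ → ℝ) : Prop :=
  ∀ s t : ℝ, s ≠ 0 → t ≠ 0 → s < t → f s / |s| < f t / |t|

/-- Nehari manifold membership, formulated with the pairing `⟨J'(u), u⟩ = 0`. -/
def memNehari {N : ℕ} (α : ℝ) (V K : EN N → ℝ) (f : ℝ → ℝ) (u : EN N → ℝ) : Prop :=
  memX α V u ∧ NotAEZero u ∧ Jd α V K f u u = 0

/-- Nehari manifold membership, formulated as `‖u‖² = ∫ K f(u) u`. -/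
def memNehari2 {N : ℕ} (α : ℝ) (V K : EN N → ℝ) (f : ℝ → ℝ) (u : EN N → ℝ) : Prop :=
  memX α V u ∧ NotAEZero u ∧ (normSq α V u).toReal = ∫ x, K x * f (u x) * u x

/-- Nodal (sign-changing) Nehari set membership. -/
def memM {N : ℕ} (α : ℝ) (V K : EN N → ℝ) (f : ℝ → ℝ) (u : EN N → ℝ) : Prop :=
  memNehari α V K f u ∧ NotAEZero (uplus u) ∧ NotAEZero (uminus u) ∧
    Jd α V K f u (uplus u) = 0 ∧ Jd α V K f u (uminus u) = 0

/-- Weak convergence in `X` of the sequence `u` to `w`. -/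
def weakConv {N : ℕ} (α : ℝ) (V : EN N → ℝ) (u : ℕ → EN N → ℝ) (w : EN N → ℝ) : Prop :=
  ∀ v : EN N → ℝ, memX α V v →
    Tendsto (fun n =>
      (∫ p : EN N × EN N,
        ((u n p.1 - w p.1) - (u n p.2 - w p.2)) * (v p.1 - v p.2)
          / ‖p.1 - p.2‖ ^ ((N : ℝ) + 2 * α))
      + ∫ x, V x * (u n x - w x) * v x) atTop (nhds 0)

end ZeroMass

namespace ZeroMass

/-- The inner integral `∫ |u(x) - u(y)|² / |x - y|^{N+2α} dy` of the Gagliardo seminorm. -/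
def gagAt (N : ℕ) (α : ℝ) (u : EN N → ℝ) (x : EN N) : ENNReal :=
  ∫⁻ y : EN N, ENNReal.ofReal ((u x - u y) ^ 2 / ‖x - y‖ ^ ((N : ℝ) + 2 * α))

lemma measurable_gagDensity {N : ℕ} (α : ℝ) {u : EN N → ℝ} (hu : Measurable u) :
    Measurable (fun p : EN N × EN N =>
      (u p.1 - u p.2) ^ 2 / ‖p.1 - p.2‖ ^ ((N : ℝ) + 2 * α)) := by
  fun_prop

lemma lintegral_gagAt {N : ℕ} (α : ℝ) {u : EN N → ℝ} (hu : Measurable u) :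
    ∫⁻ x, gagAt N α u x = gagSq N α u := by
  unfold gagAt gagSq
  rw [Measure.volume_eq_prod, lintegral_prod]
  exact (measurable_gagDensity α hu).ennreal_ofReal.aemeasurable

/-- On a ball near `x` where `w` is mostly below `|w x| / 2`, the oscillation of `w` bounds
`gagAt` from below. -/
lemma le_gagAt_of_ball {N : ℕ} {α q r : ℝ} (hp : 0 ≤ (N : ℝ) + 2 * α) (hq : 0 ≤ q)
    {u w : EN N → ℝ} (hu : Measurable u) {x z : EN N} (hr : 0 < r)
    (hs : 0 < |w x|) (hD : Metric.ball z (r / 2) ⊆ Metric.closedBall x r)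
    (huw : ∀ y, |w x - w y| ≤ |u x - u y|)
    (hA : 2 * (ENNReal.ofReal ((2 / |w x|) ^ q) *
      ∫⁻ y in Metric.ball z (r / 2), ENNReal.ofReal (|w y| ^ q))
        ≤ volume (Metric.ball z (r / 2))) :
    ENNReal.ofReal (|w x| ^ 2 / (8 * r ^ ((N : ℝ) + 2 * α))) * volume (Metric.ball z (r / 2))
      ≤ gagAt N α u x := by
  set s := |w x| with hsdef
  set p := (N : ℝ) + 2 * α with hpdef
  set D := Metric.ball z (r / 2) with hDdef
  have hrp : 0 < r ^ p := Real.rpow_pos_of_pos hr p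
  set a := s ^ 2 / (8 * r ^ p) with ha
  have ha0 : 0 < a := by positivity
  have hpt : ∀ y ∈ D, 2 * ENNReal.ofReal a ≤
      ENNReal.ofReal ((u x - u y) ^ 2 / ‖x - y‖ ^ p) +
        2 * ENNReal.ofReal a * ENNReal.ofReal ((2 / s) ^ q) * ENNReal.ofReal (|w y| ^ q) := by
    intro y hy
    have hxy : ‖x - y‖ ≤ r := by
      have := hD hy
      rwa [Metric.mem_closedBall, dist_comm, dist_eq_norm] at this
    rcases le_or_gt (s / 2) |w y| with h | h
    · refine le_add_left ?_
      rw [mul_assoc]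
      refine le_mul_of_one_le_right (by positivity) ?_
      rw [← ENNReal.ofReal_mul (by positivity), ← Real.mul_rpow (by positivity) (by positivity)]
      rw [ENNReal.one_le_ofReal]
      refine Real.one_le_rpow ?_ hq
      rw [div_mul_eq_mul_div, le_div_iff₀ hs]
      linarith
    · refine le_add_right ?_
      have hux : s / 2 ≤ |u x - u y| := by
        have h1 := huw y
        have h2 := abs_sub_abs_le_abs_sub (w x) (w y)
        linarith
      have hne : 0 < ‖x - y‖ := by
        rw [norm_pos_iff, sub_ne_zero]
        rintro rfl
        simp at hux
        linarith
      have h2 : 2 * ENNReal.ofReal a = ENNReal.ofReal (2 * a) := by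
        rw [ENNReal.ofReal_mul (by norm_num)]
        simp
      rw [h2]
      refine ENNReal.ofReal_le_ofReal ?_
      have hle : ‖x - y‖ ^ p ≤ r ^ p := Real.rpow_le_rpow hne.le hxy hp
      have hpos : 0 < ‖x - y‖ ^ p := Real.rpow_pos_of_pos hne p
      have hsq : (s / 2) ^ 2 ≤ (u x - u y) ^ 2 := by
        rw [← sq_abs (u x - u y)]
        gcongr
      calc 2 * a = (s / 2) ^ 2 / r ^ p := by rw [ha]; field_simp; norm_num
        _ ≤ (u x - u y) ^ 2 / ‖x - y‖ ^ p := by gcongr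
  have hint : 2 * ENNReal.ofReal a * volume D ≤ gagAt N α u x +
      2 * ENNReal.ofReal a * ENNReal.ofReal ((2 / s) ^ q) *
        ∫⁻ y in D, ENNReal.ofReal (|w y| ^ q) := by
    calc 2 * ENNReal.ofReal a * volume D = ∫⁻ y in D, 2 * ENNReal.ofReal a := by
          rw [setLIntegral_const]
      _ ≤ ∫⁻ y in D, (ENNReal.ofReal ((u x - u y) ^ 2 / ‖x - y‖ ^ p) +
        2 * ENNReal.ofReal a * ENNReal.ofReal ((2 / s) ^ q) * ENNReal.ofReal (|w y| ^ q)) :=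
          setLIntegral_mono' Metric.isOpen_ball.measurableSet hpt
      _ = (∫⁻ y in D, ENNReal.ofReal ((u x - u y) ^ 2 / ‖x - y‖ ^ p)) +
        2 * ENNReal.ofReal a * ENNReal.ofReal ((2 / s) ^ q) *
          ∫⁻ y in D, ENNReal.ofReal (|w y| ^ q) := by
          rw [lintegral_add_left (by fun_prop), lintegral_const_mul' _ _ (by finiteness)]
      _ ≤ _ := by
          gcongr
          exact setLIntegral_le_lintegral _ _
  have hfin : volume D ≠ ⊤ := measure_ball_lt_top.ne
  have hA' : 2 * ENNReal.ofReal a * ENNReal.ofReal ((2 / s) ^ q) *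
        ∫⁻ y in D, ENNReal.ofReal (|w y| ^ q) ≤ ENNReal.ofReal a * volume D := by
    calc _ = ENNReal.ofReal a * (2 * (ENNReal.ofReal ((2 / s) ^ q) *
        ∫⁻ y in D, ENNReal.ofReal (|w y| ^ q))) := by ring
      _ ≤ _ := by gcongr
  have hfin2 : ENNReal.ofReal a * volume D ≠ ⊤ := by finiteness
  refine ENNReal.le_of_add_le_add_right hfin2 ?_
  calc _ = 2 * ENNReal.ofReal a * volume D := by ring
    _ ≤ _ := hint
    _ ≤ _ := by gcongr

/-- If `w` has mean zero on a ball around the origin, its value at a point of the ball is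
controlled by `gagAt`. -/
lemma le_gagAt_of_mean_zero {N : ℕ} {α R B : ℝ} (hp : 0 ≤ (N : ℝ) + 2 * α) (hR : 0 < R)
    {u w : EN N → ℝ} (hw : Measurable w) (hB : ∀ y, |w y| ≤ B)
    {x : EN N} (hx : x ∈ Metric.ball (0 : EN N) R)
    (huw : ∀ y, |w x - w y| ≤ |u x - u y|)
    (hmean : ∫ y in Metric.ball (0 : EN N) R, w y = 0) :
    ENNReal.ofReal (|w x| ^ 2 / (2 * R) ^ ((N : ℝ) + 2 * α)) * volume (Metric.ball (0 : EN N) R)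
      ≤ gagAt N α u x := by
  set D := Metric.ball (0 : EN N) R with hDdef
  set p := (N : ℝ) + 2 * α with hpdef
  have hfin : volume D ≠ ⊤ := measure_ball_lt_top.ne
  have hRp : 0 < (2 * R) ^ p := Real.rpow_pos_of_pos (by positivity) p
  have hB0 : 0 ≤ B := (abs_nonneg _).trans (hB x)
  have hwi : IntegrableOn w D :=
    Measure.integrableOn_of_bounded hfin hw.aestronglyMeasurable (Eventually.of_forall hB)
  have hwi2 : IntegrableOn (fun y => w y ^ 2) D := by
    refine Measure.integrableOn_of_bounded (M := B ^ 2) hfin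
      (hw.pow_const 2).aestronglyMeasurable (Eventually.of_forall fun y => ?_)
    rw [Real.norm_eq_abs, abs_pow]
    gcongr
    exact hB y
  have hci : IntegrableOn (fun _ : EN N => w x ^ 2) D := integrableOn_const hfin
  have hexp : (fun y => (w x - w y) ^ 2) = fun y => w x ^ 2 - 2 * w x * w y + w y ^ 2 := by
    ext y; ring
  have hi1 : IntegrableOn (fun y => w x ^ 2 - 2 * w x * w y) D := hci.sub (hwi.const_mul _)
  have hint : IntegrableOn (fun y => (w x - w y) ^ 2) D := by
    rw [hexp]; exact hi1.add hwi2
  have hlow : w x ^ 2 * volume.real D ≤ ∫ y in D, (w x - w y) ^ 2 := by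
    rw [hexp, integral_add hi1 hwi2, integral_sub hci (hwi.const_mul _), integral_const_mul,
      hmean, setIntegral_const, smul_eq_mul]
    have : 0 ≤ ∫ y in D, w y ^ 2 := integral_nonneg fun y => sq_nonneg _
    linarith
  have hlow' : ENNReal.ofReal (|w x| ^ 2) * volume D ≤
      ∫⁻ y in D, ENNReal.ofReal ((w x - w y) ^ 2) := by
    rw [← ofReal_integral_eq_lintegral_ofReal hint (Eventually.of_forall fun y => sq_nonneg _),
      ← ofReal_measureReal hfin, ← ENNReal.ofReal_mul (by positivity), sq_abs]
    exact ENNReal.ofReal_le_ofReal hlow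
  calc ENNReal.ofReal (|w x| ^ 2 / (2 * R) ^ p) * volume D
      = ENNReal.ofReal ((2 * R) ^ p)⁻¹ * (ENNReal.ofReal (|w x| ^ 2) * volume D) := by
        rw [← mul_assoc, ← ENNReal.ofReal_mul (by positivity), div_eq_inv_mul]
    _ ≤ ENNReal.ofReal ((2 * R) ^ p)⁻¹ * ∫⁻ y in D, ENNReal.ofReal ((w x - w y) ^ 2) := by
        gcongr
    _ = ∫⁻ y in D, ENNReal.ofReal ((2 * R) ^ p)⁻¹ * ENNReal.ofReal ((w x - w y) ^ 2) := by
        rw [lintegral_const_mul' _ _ (by finiteness)]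
    _ ≤ ∫⁻ y in D, ENNReal.ofReal ((u x - u y) ^ 2 / ‖x - y‖ ^ p) := by
        refine setLIntegral_mono' Metric.isOpen_ball.measurableSet fun y hy => ?_
        rw [← ENNReal.ofReal_mul (by positivity), ← div_eq_inv_mul]
        refine ENNReal.ofReal_le_ofReal ?_
        rcases eq_or_ne x y with rfl | hne
        · simp
        have hpos : 0 < ‖x - y‖ := norm_pos_iff.2 (sub_ne_zero.2 hne)
        have hle : ‖x - y‖ ≤ 2 * R := by
          have h1 := norm_sub_le x y
          rw [mem_ball_zero_iff] at hx hy
          linarith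
        have h3 : 0 < ‖x - y‖ ^ p := Real.rpow_pos_of_pos hpos p
        have h4 : ‖x - y‖ ^ p ≤ (2 * R) ^ p := Real.rpow_le_rpow hpos.le hle hp
        have h5 : (w x - w y) ^ 2 ≤ (u x - u y) ^ 2 := sq_le_sq.2 (huw y)
        gcongr
    _ ≤ _ := setLIntegral_le_lintegral _ _

lemma volume_ball_eq {N : ℕ} (z : EN N) {r : ℝ} (hr : 0 < r) :
    volume (Metric.ball z r) =
      ENNReal.ofReal (r ^ N * volume.real (Metric.ball (0 : EN N) 1)) := by
  rw [Measure.addHaar_ball_of_pos _ _ hr, finrank_euclideanSpace_fin,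
    ENNReal.ofReal_mul (by positivity), ofReal_measureReal measure_ball_lt_top.ne]

lemma volume_real_unitBall_pos (N : ℕ) : 0 < volume.real (Metric.ball (0 : EN N) 1) :=
  ENNReal.toReal_pos (Metric.measure_ball_pos _ _ one_pos).ne' measure_ball_lt_top.ne

lemma critExp_identity {N : ℕ} {α : ℝ} (hN : 2 * α < N) :
    critExp N α * (N - 2 * α) = 2 * N := by
  unfold critExp
  have : (N : ℝ) - 2 * α ≠ 0 := by linarith
  field_simp

lemma two_lt_critExp {N : ℕ} {α : ℝ} (hα : 0 < α) (hN : 2 * α < N) : 2 < critExp N α := by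
  unfold critExp
  rw [lt_div_iff₀ (by linarith)]
  linarith

/-- Pointwise estimate behind the fractional Sobolev–Poincaré inequality on balls. -/
lemma exists_pointwise_bound {N : ℕ} {α : ℝ} (hα : 0 < α) (hN : 2 * α < N) :
    ∃ c : ℝ, 0 < c ∧ ∀ (R B A : ℝ) (u w : EN N → ℝ) (x : EN N), 0 < R → 0 < A →
      Measurable u → Measurable w → (∀ y, |w y| ≤ B) → (∀ y, |w x - w y| ≤ |u x - u y|) →
      x ∈ Metric.ball (0 : EN N) R → ∫ y in Metric.ball (0 : EN N) R, w y = 0 →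
      ∫⁻ y in Metric.ball (0 : EN N) R, ENNReal.ofReal (|w y| ^ critExp N α)
        ≤ ENNReal.ofReal A →
      ENNReal.ofReal (c * |w x| ^ critExp N α) ≤
        ENNReal.ofReal (A ^ (2 * α / N)) * gagAt N α u x := by
  have hN0 : (0 : ℝ) < N := by linarith
  have hq2 := two_lt_critExp hα hN
  have hqid := critExp_identity hN
  set q := critExp N α with hq
  set ω := volume.real (Metric.ball (0 : EN N) 1) with hω
  have hω0 : 0 < ω := volume_real_unitBall_pos N
  set θ := 2 * α / (N : ℝ) with hθ
  set E := 2 * 2 ^ q / ω with hE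
  have hE0 : 0 < E := by positivity
  refine ⟨ω / (8 * 2 ^ N) / (2 ^ (2 * α) * E ^ θ), by positivity, ?_⟩
  intro R B A u w x hR hA hu hw hB huw hx hmean hint
  rcases (abs_nonneg (w x)).eq_or_lt with hs | hs
  · rw [← hs, Real.zero_rpow (by linarith)]
    simp
  set s := |w x| with hsdef
  have hp : 0 ≤ (N : ℝ) + 2 * α := by positivity
  have hsq : 0 < s ^ q := Real.rpow_pos_of_pos hs q
  set ρ := (E * A / s ^ q) ^ (1 / (N : ℝ)) with hρ
  have hbase : 0 < E * A / s ^ q := by positivity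
  have hρ0 : 0 < ρ := Real.rpow_pos_of_pos hbase _
  have hρN : ρ ^ N = E * A / s ^ q := by
    rw [hρ, ← Real.rpow_natCast, ← Real.rpow_mul hbase.le, one_div, inv_mul_cancel₀ hN0.ne',
      Real.rpow_one]
  have hkey : ENNReal.ofReal (ω / (8 * 2 ^ N) * s ^ 2 / (2 * ρ) ^ (2 * α)) ≤ gagAt N α u x := by
    rcases le_or_gt ρ R with hle | hlt
    · set l := ρ / R with hl
      have hl0 : 0 < l := by positivity
      have hl1 : l ≤ 1 := (div_le_one hR).2 hle
      have hlR : l * R = ρ := by rw [hl]; field_simp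
      rw [mem_ball_zero_iff] at hx
      have hxl : ‖l • x‖ ≤ ρ := by
        rw [norm_smul, Real.norm_of_nonneg hl0.le, ← hlR]
        gcongr
      have hDx : Metric.ball ((1 - l) • x) (2 * ρ / 2) ⊆ Metric.closedBall x (2 * ρ) := by
        refine Metric.ball_subset_closedBall.trans (Metric.closedBall_subset_closedBall' ?_)
        rw [dist_eq_norm]
        have : (1 - l) • x - x = -(l • x) := by rw [sub_smul, one_smul]; abel
        rw [this, norm_neg]
        linarith
      have hDR : Metric.ball ((1 - l) • x) (2 * ρ / 2) ⊆ Metric.ball 0 R := by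
        refine Metric.ball_subset_ball' ?_
        rw [dist_zero_right, norm_smul, Real.norm_of_nonneg (by linarith)]
        nlinarith [norm_nonneg x]
      have hvol := volume_ball_eq ((1 - l) • x) (show 0 < 2 * ρ / 2 by positivity)
      have h := le_gagAt_of_ball (α := α) (q := q) hp (by linarith) hu
        (show 0 < 2 * ρ by positivity) hs hDx huw ?_
      · refine le_trans (le_of_eq ?_) h
        rw [hvol, ← ENNReal.ofReal_mul (by positivity)]
        congr 1
        rw [Real.rpow_add (by positivity), Real.rpow_natCast, mul_pow, ← hω, ← hsdef]
        field_simp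
      · rw [hvol]
        calc _ ≤ 2 * (ENNReal.ofReal ((2 / s) ^ q) * ENNReal.ofReal A) := by
              gcongr
              exact (lintegral_mono_set hDR).trans hint
          _ = ENNReal.ofReal (2 * ((2 / s) ^ q * A)) := by
              rw [← ENNReal.ofReal_mul (by positivity), ENNReal.ofReal_mul (p := 2) (by norm_num)]
              simp
          _ ≤ _ := by
              refine ENNReal.ofReal_le_ofReal (le_of_eq ?_)
              rw [mul_div_cancel_left₀ _ (by norm_num : (2 : ℝ) ≠ 0), hρN, ← hω, hE,
                Real.div_rpow (by norm_num) hs.le]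
              field_simp
    · refine le_trans ?_ (le_gagAt_of_mean_zero (α := α) hp hR hw hB hx huw hmean)
      rw [volume_ball_eq _ hR, ← ENNReal.ofReal_mul (by positivity), ← hω, ← hsdef]
      refine ENNReal.ofReal_le_ofReal ?_
      have h1 : s ^ 2 / (2 * R) ^ ((N : ℝ) + 2 * α) * (R ^ N * ω) =
          ω / (1 * 2 ^ N) * s ^ 2 / (2 * R) ^ (2 * α) := by
        rw [Real.rpow_add (by positivity), Real.rpow_natCast, mul_pow]
        field_simp
      rw [h1]
      gcongr
      norm_num
  have hpow : (2 * ρ) ^ (2 * α) = 2 ^ (2 * α) * (E ^ θ * A ^ θ / s ^ (q * θ)) := by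
    rw [Real.mul_rpow (by norm_num) hρ0.le, hρ, ← Real.rpow_mul hbase.le,
      show 1 / (N : ℝ) * (2 * α) = θ by rw [hθ]; ring,
      Real.div_rpow (by positivity) hsq.le, Real.mul_rpow hE0.le hA.le, ← Real.rpow_mul hs.le]
  have hsplit : s ^ q = s ^ 2 * s ^ (q * θ) := by
    rw [← Real.rpow_natCast, ← Real.rpow_add hs]
    congr 1
    rw [hθ]
    push_cast
    field_simp
    linarith
  calc ENNReal.ofReal (ω / (8 * 2 ^ N) / (2 ^ (2 * α) * E ^ θ) * s ^ q)
      = ENNReal.ofReal (A ^ θ * (ω / (8 * 2 ^ N) * s ^ 2 / (2 * ρ) ^ (2 * α))) := by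
        congr 1
        rw [hpow, hsplit]
        field_simp
    _ = ENNReal.ofReal (A ^ θ) *
          ENNReal.ofReal (ω / (8 * 2 ^ N) * s ^ 2 / (2 * ρ) ^ (2 * α)) :=
        ENNReal.ofReal_mul (by positivity)
    _ ≤ _ := by gcongr

/-- Fractional Sobolev–Poincaré inequality on balls, with a constant independent of the radius
and of the bounded function `w`. -/
lemma exists_sobolev_poincare {N : ℕ} {α : ℝ} (hα : 0 < α) (hN : 2 * α < N)
    {u : EN N → ℝ} (hu : Measurable u) (hg : gagSq N α u ≠ ⊤) :
    ∃ M : ℝ, 0 ≤ M ∧ ∀ (R B : ℝ) (w : EN N → ℝ), 0 < R → Measurable w → (∀ y, |w y| ≤ B) →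
      (∀ x y, |w x - w y| ≤ |u x - u y|) → ∫ y in Metric.ball (0 : EN N) R, w y = 0 →
      ∫⁻ y in Metric.ball (0 : EN N) R, ENNReal.ofReal (|w y| ^ critExp N α)
        ≤ ENNReal.ofReal M := by
  obtain ⟨c, hc, hcb⟩ := exists_pointwise_bound hα hN
  have hq2 := two_lt_critExp hα hN
  have hN0 : (0 : ℝ) < N := by linarith
  set q := critExp N α with hq
  set θ := 2 * α / (N : ℝ) with hθ
  have hθ1 : 0 < 1 - θ := by
    rw [hθ, sub_pos, div_lt_one hN0]; exact hN
  set G := (gagSq N α u).toReal with hG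
  have hG0 : 0 ≤ G := ENNReal.toReal_nonneg
  refine ⟨(G / c) ^ (1 / (1 - θ)), by positivity, ?_⟩
  intro R B w hR hw hB huw hmean
  set D := Metric.ball (0 : EN N) R
  have hfin : volume D ≠ ⊤ := measure_ball_lt_top.ne
  have hint : IntegrableOn (fun y => |w y| ^ q) D := by
    refine Measure.integrableOn_of_bounded (M := B ^ q) hfin
      (hw.abs.pow_const q).aestronglyMeasurable (Eventually.of_forall fun y => ?_)
    rw [Real.norm_of_nonneg (by positivity)]
    exact Real.rpow_le_rpow (abs_nonneg _) (hB y) (by linarith)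
  set A := ∫ y in D, |w y| ^ q with hA
  have hAeq : ∫⁻ y in D, ENNReal.ofReal (|w y| ^ q) = ENNReal.ofReal A :=
    (ofReal_integral_eq_lintegral_ofReal hint
      (Eventually.of_forall fun y => by positivity)).symm
  rw [hAeq]
  refine ENNReal.ofReal_le_ofReal ?_
  have hA0 : 0 ≤ A := integral_nonneg fun y => by positivity
  rcases hA0.eq_or_lt with h0 | hApos
  · rw [← h0]; positivity
  have hmain : ENNReal.ofReal (c * A) ≤ ENNReal.ofReal (A ^ θ * G) := by
    rw [ENNReal.ofReal_mul hc.le, ← hAeq, ← lintegral_const_mul' _ _ (by finiteness),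
      ENNReal.ofReal_mul (by positivity), hG, ENNReal.ofReal_toReal hg, ← lintegral_gagAt α hu,
      ← lintegral_const_mul' _ _ (by finiteness)]
    refine le_trans (setLIntegral_mono' Metric.isOpen_ball.measurableSet fun x hx => ?_)
      (setLIntegral_le_lintegral _ _)
    rw [← ENNReal.ofReal_mul hc.le]
    exact hcb R B A u w x hR hApos hu hw hB (huw x) hx hmean hAeq.le
  rw [ENNReal.ofReal_le_ofReal_iff (by positivity)] at hmain
  have hAθ : A ^ (1 - θ) ≤ G / c := by
    rw [Real.rpow_sub hApos, Real.rpow_one, div_le_div_iff₀ (by positivity) hc]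
    linarith
  calc A = (A ^ (1 - θ)) ^ (1 / (1 - θ)) := by
        rw [← Real.rpow_mul hA0, mul_one_div_cancel hθ1.ne', Real.rpow_one]
    _ ≤ _ := by gcongr

/-- A function with finite Gagliardo seminorm lies in `L^{2*_α}` above some level. -/
lemma exists_level_lintegral_lt_top {N : ℕ} {α : ℝ} (hα : 0 < α) (hN : 2 * α < N)
    {u : EN N → ℝ} (hu : Measurable u) (hg : gagSq N α u ≠ ⊤) :
    ∃ L : ℝ, 0 ≤ L ∧
      ∫⁻ x, ENNReal.ofReal ((max (|u x| - L) 0) ^ critExp N α) < ⊤ := by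
  obtain ⟨M, hM0, hM⟩ := exists_sobolev_poincare hα hN hu hg
  have hq2 := two_lt_critExp hα hN
  set q := critExp N α with hq
  set D : ℕ → Set (EN N) := fun n => Metric.ball 0 ((n : ℝ) + 1) with hD
  have hDfin : ∀ n, volume (D n) ≠ ⊤ := fun n => measure_ball_lt_top.ne
  have hDpos : ∀ n, volume (D n) ≠ 0 := fun n =>
    (Metric.measure_ball_pos _ _ (by positivity)).ne'
  set v : ℕ → EN N → ℝ := fun n x => min |u x| n with hv
  have hvm : ∀ n, Measurable (v n) := fun n => by fun_prop
  have hv0 : ∀ n x, 0 ≤ v n x := fun n x => le_min (abs_nonneg _) (Nat.cast_nonneg n)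
  have hvn : ∀ n x, v n x ≤ n := fun n x => min_le_right _ _
  have hvi : ∀ n, IntegrableOn (v n) (D n) := fun n =>
    Measure.integrableOn_of_bounded (M := n) (hDfin n) (hvm n).aestronglyMeasurable
      (Eventually.of_forall fun y => by rw [Real.norm_of_nonneg (hv0 n y)]; exact hvn n y)
  set m : ℕ → ℝ := fun n => ⨍ x in D n, v n x with hm
  have hbound : ∀ n, ∫⁻ y in D n, ENNReal.ofReal (|v n y - m n| ^ q) ≤ ENNReal.ofReal M := by
    intro n
    refine hM _ (n + |m n|) (fun y => v n y - m n) (by positivity) ((hvm n).sub_const _) ?_ ?_ ?_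
    · intro y
      refine (abs_sub _ _).trans ?_
      gcongr
      rw [abs_of_nonneg (hv0 n y)]
      exact hvn n y
    · intro x y
      rw [sub_sub_sub_cancel_right]
      refine (abs_min_sub_min_le_max _ _ _ _).trans ?_
      rw [sub_self, abs_zero, max_eq_left (abs_nonneg _)]
      exact abs_abs_sub_abs_le _ _
    · rw [integral_sub (hvi n) (integrableOn_const (hDfin n)), setIntegral_const, hm]
      simp only
      rw [measure_smul_setAverage _ (hDfin n), sub_self]
  obtain ⟨k, hk⟩ : ∃ k : ℕ, volume (D 0 ∩ {x | |u x| ≤ k}) ≠ 0 := by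
    by_contra! h
    refine hDpos 0 (measure_mono_null ?_ (measure_iUnion_null h))
    intro x hx
    obtain ⟨k, hk⟩ := exists_nat_ge |u x|
    exact Set.mem_iUnion.2 ⟨k, hx, hk⟩
  set S := D 0 ∩ {x | |u x| ≤ k} with hS
  have hSm : MeasurableSet S :=
    Metric.isOpen_ball.measurableSet.inter (measurableSet_le (by fun_prop) (by fun_prop))
  have hSfin : volume S ≠ ⊤ := measure_ne_top_of_subset Set.inter_subset_left (hDfin 0)
  have hSpos : 0 < volume.real S := ENNReal.toReal_pos hk hSfin
  have hSD : ∀ n, S ⊆ D n := fun n =>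
    Set.inter_subset_left.trans (Metric.ball_subset_ball (by simp))
  set L := k + (M / volume.real S) ^ (1 / q) with hL
  have hL0 : 0 ≤ L := by positivity
  have hmL : ∀ n, m n ≤ L := by
    intro n
    rcases le_or_gt (m n) k with h | h
    · have : 0 ≤ (M / volume.real S) ^ (1 / q) := by positivity
      linarith
    have h1 : ENNReal.ofReal ((m n - k) ^ q * volume.real S) ≤ ENNReal.ofReal M := by
      refine le_trans ?_ (hbound n)
      rw [ENNReal.ofReal_mul (Real.rpow_nonneg (by linarith) _), ofReal_measureReal hSfin,
        ← setLIntegral_const]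
      refine le_trans (setLIntegral_mono' hSm fun x hx => ?_) (lintegral_mono_set (hSD n))
      refine ENNReal.ofReal_le_ofReal (Real.rpow_le_rpow (by linarith) ?_ (by linarith))
      have h2 : v n x ≤ k := (min_le_left _ _).trans hx.2
      rw [abs_sub_comm]
      refine le_trans ?_ (le_abs_self _)
      linarith
    rw [ENNReal.ofReal_le_ofReal_iff hM0] at h1
    have h2 : (m n - k) ^ q ≤ M / volume.real S := by rwa [le_div_iff₀ hSpos]
    have h3 : m n - k ≤ (M / volume.real S) ^ (1 / q) := by
      calc m n - k = ((m n - k) ^ q) ^ (1 / q) := by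
            rw [← Real.rpow_mul (by linarith), mul_one_div_cancel (by linarith), Real.rpow_one]
        _ ≤ _ := Real.rpow_le_rpow (Real.rpow_nonneg (by linarith) _) h2 (by positivity)
    linarith
  refine ⟨L, hL0, ?_⟩
  set φ : ℕ → EN N → ENNReal := fun n =>
    (D n).indicator fun x => ENNReal.ofReal ((max (v n x - L) 0) ^ q) with hφ
  have hφm : ∀ n, Measurable (φ n) := fun n => by
    refine Measurable.indicator ?_ Metric.isOpen_ball.measurableSet
    exact ((((hvm n).sub_const L).max measurable_const).pow_const q).ennreal_ofReal
  have hφb : ∀ n, ∫⁻ x, φ n x ≤ ENNReal.ofReal M := by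
    intro n
    rw [hφ]
    simp only
    rw [lintegral_indicator Metric.isOpen_ball.measurableSet]
    refine le_trans (lintegral_mono fun x => ?_) (hbound n)
    refine ENNReal.ofReal_le_ofReal (Real.rpow_le_rpow (le_max_right _ _) ?_ (by linarith))
    refine max_le ?_ (abs_nonneg _)
    have := hmL n
    refine le_trans ?_ (le_abs_self _)
    linarith
  have hlim : ∀ x, liminf (fun n => φ n x) atTop =
      ENNReal.ofReal ((max (|u x| - L) 0) ^ q) := by
    intro x
    refine Tendsto.liminf_eq (tendsto_const_nhds.congr' ?_)
    obtain ⟨j, hj⟩ := exists_nat_ge (max |u x| ‖x‖)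
    filter_upwards [eventually_ge_atTop j] with n hn
    have hjn : (j : ℝ) ≤ n := by exact_mod_cast hn
    have h1 : |u x| ≤ n := (le_max_left _ _).trans (hj.trans hjn)
    have h2 : x ∈ D n := by
      rw [hD]
      simp only [mem_ball_zero_iff]
      have := (le_max_right |u x| ‖x‖).trans (hj.trans hjn)
      linarith
    rw [hφ]
    simp only [Set.indicator_of_mem h2, hv, min_eq_left h1]
  calc ∫⁻ x, ENNReal.ofReal ((max (|u x| - L) 0) ^ q)
      = ∫⁻ x, liminf (fun n => φ n x) atTop := by simp_rw [hlim]
    _ ≤ liminf (fun n => ∫⁻ x, φ n x) atTop := lintegral_liminf_le hφm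
    _ ≤ ENNReal.ofReal M :=
        liminf_le_of_le (by isBoundedDefault) fun b hb => by
          obtain ⟨n, hn⟩ := hb.exists
          exact hn.trans (hφb n)
    _ < ⊤ := ENNReal.ofReal_lt_top

/-- A function of `X` belongs to the weighted spaces with weight `K` and exponents `2` and
`2*_α`. -/
lemma integrable_weight {N : ℕ} {α : ℝ} (hα : 0 < α) (hN : 2 * α < N)
    {V K : EN N → ℝ} (hV : Continuous V) (hK : Continuous K) (h1 : H1 V K) (h3 : H3 V K)
    {u : EN N → ℝ} (hu : memX α V u) :
    Integrable (fun x => K x * u x ^ 2) ∧ Integrable (fun x => K x * |u x| ^ critExp N α) := by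
  obtain ⟨hV0, hK0, C, hC⟩ := h1
  obtain ⟨C', hC'⟩ := h3
  obtain ⟨hum, hun⟩ := hu
  have hq2 := two_lt_critExp hα hN
  obtain ⟨hg, hVu⟩ := ENNReal.add_lt_top.1 hun
  obtain ⟨L, hL0, hL⟩ := exists_level_lintegral_lt_top hα hN hum hg.ne
  set q := critExp N α with hq
  have hVmeas : Measurable V := hV.measurable
  have hKmeas : Measurable K := hK.measurable
  have hi1 : Integrable (fun x => V x * u x ^ 2) := by
    refine ⟨by fun_prop, ?_⟩
    rw [hasFiniteIntegral_iff_ofReal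
      (Eventually.of_forall fun x => mul_nonneg (hV0 x).le (sq_nonneg _))]
    exact hVu
  have hi2 : Integrable (fun x => (max (|u x| - L) 0) ^ q) := by
    have hm : Measurable (fun x => (max (|u x| - L) 0) ^ q) := by fun_prop
    refine ⟨hm.aestronglyMeasurable, ?_⟩
    rw [hasFiniteIntegral_iff_ofReal
      (Eventually.of_forall fun x => Real.rpow_nonneg (le_max_right _ _) _)]
    exact hL
  have hKV : ∀ x, K x ≤ C' * V x := fun x => (div_le_iff₀ (hV0 x)).1 (hC' x)
  have hC0 : 0 ≤ C := (hK0 0).le.trans (hC 0)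
  have hi3 : Integrable (fun x => K x * u x ^ 2) := by
    refine (hi1.const_mul C').mono' (by fun_prop) (Eventually.of_forall fun x => ?_)
    rw [Real.norm_of_nonneg (mul_nonneg (hK0 x).le (sq_nonneg _)), ← mul_assoc]
    gcongr
    exact hKV x
  refine ⟨hi3, ((hi2.const_mul (C * 2 ^ q)).add (hi3.const_mul ((2 * L) ^ (q - 2)))).mono'
    (by fun_prop) (Eventually.of_forall fun x => ?_)⟩
  have hKx := (hK0 x).le
  rw [Real.norm_of_nonneg (by positivity), Pi.add_apply]
  rcases le_or_gt |u x| (2 * L) with h | h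
  · refine le_add_of_nonneg_of_le
      (mul_nonneg (by positivity) (Real.rpow_nonneg (le_max_right _ _) _)) ?_
    have : |u x| ^ q = |u x| ^ (q - 2) * u x ^ 2 := by
      rw [← sq_abs (u x), ← Real.rpow_natCast, ← Real.rpow_add_of_nonneg (abs_nonneg _)
        (by linarith) (by norm_num)]
      congr 1
      push_cast
      ring
    rw [this, mul_left_comm]
    gcongr
  · refine le_add_of_le_of_nonneg ?_ (by positivity)
    rw [max_eq_left (by linarith), mul_assoc, ← Real.mul_rpow (by norm_num) (by linarith)]
    gcongr
    · exact hC x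
    · linarith

lemma exists_growth_bound {f : ℝ → ℝ} (hf : Continuous f) {q : ℝ} (hf1 : Cf1 f)
    (hf2 : Cf2 f q) : ∃ C : ℝ, 0 ≤ C ∧ ∀ t, |f t| ≤ C * |t| + |t| ^ (q - 1) := by
  have e1 : ∀ᶠ t in nhdsWithin (0 : ℝ) {(0 : ℝ)}ᶜ, |f t| ≤ |t| := by
    filter_upwards [(Metric.tendsto_nhds.1 hf1) 1 one_pos, self_mem_nhdsWithin] with t ht h0
    have h0' : 0 < |t| := abs_pos.2 h0
    rw [dist_zero_right, norm_div, Real.norm_eq_abs, Real.norm_eq_abs, abs_abs,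
      div_lt_one h0'] at ht
    exact ht.le
  have hf0 : f 0 = 0 := by
    have l1 : Tendsto (fun t => |f t|) (nhdsWithin (0 : ℝ) {(0 : ℝ)}ᶜ) (nhds |f 0|) :=
      (hf.abs.tendsto 0).mono_left nhdsWithin_le_nhds
    have l2 : Tendsto (fun t : ℝ => |t|) (nhdsWithin (0 : ℝ) {(0 : ℝ)}ᶜ) (nhds |(0 : ℝ)|) :=
      (continuous_abs.tendsto 0).mono_left nhdsWithin_le_nhds
    have := le_of_tendsto_of_tendsto l1 l2 e1
    simpa using this
  obtain ⟨δ, hδ, hδf⟩ := Metric.eventually_nhds_iff.1 (eventually_nhdsWithin_iff.1 e1)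
  have e2 : ∀ᶠ t in comap (fun t : ℝ => |t|) atTop, |f t| ≤ |t| ^ (q - 1) := by
    filter_upwards [(Metric.tendsto_nhds.1 hf2) 1 one_pos,
      tendsto_comap.eventually (eventually_gt_atTop (0 : ℝ))] with t ht h0
    have h0' : 0 < |t| ^ (q - 1) := Real.rpow_pos_of_pos h0 _
    rw [dist_zero_right, norm_div, Real.norm_eq_abs, Real.norm_of_nonneg h0'.le,
      div_lt_one h0'] at ht
    exact ht.le
  obtain ⟨T, hT⟩ := eventually_atTop.1 (eventually_comap.1 e2)
  obtain ⟨B, hB⟩ := (isCompact_Icc (a := -T) (b := T)).exists_bound_of_continuousOn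
    hf.continuousOn
  refine ⟨1 + |B| / δ, by positivity, fun t => ?_⟩
  have hp : 0 ≤ |t| ^ (q - 1) := by positivity
  have hC : |t| ≤ (1 + |B| / δ) * |t| :=
    le_mul_of_one_le_left (abs_nonneg _) (le_add_of_nonneg_right (by positivity))
  rcases lt_or_ge |t| δ with h | h
  · rcases eq_or_ne t 0 with rfl | h0
    · rw [hf0, abs_zero]; positivity
    · have := hδf (by rwa [dist_zero_right]) h0
      linarith
  rcases le_or_gt T |t| with h' | h'
  · have := hT _ h' t rfl
    have : 0 ≤ (1 + |B| / δ) * |t| := by positivity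
    linarith
  · have h1 := hB t (abs_le.1 h'.le)
    rw [Real.norm_eq_abs] at h1
    have h2 : |B| ≤ |B| / δ * |t| := by
      rw [div_mul_eq_mul_div, le_div_iff₀ hδ]
      gcongr
    have h3 : B ≤ |B| := le_abs_self B
    have h4 : (1 + |B| / δ) * |t| = |t| + |B| / δ * |t| := by ring
    have := abs_nonneg t
    linarith

lemma abs_prim_le {f : ℝ → ℝ} {q C : ℝ} (hq : 1 < q) (hC : 0 ≤ C)
    (h : ∀ t, |f t| ≤ C * |t| + |t| ^ (q - 1)) (t : ℝ) :
    |prim f t| ≤ C * t ^ 2 + |t| ^ q := by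
  have hb : ∀ τ ∈ Set.uIoc (0 : ℝ) t, ‖f τ‖ ≤ C * |t| + |t| ^ (q - 1) := by
    intro τ hτ
    have hle : |τ| ≤ |t| := by
      have := Set.abs_sub_left_of_mem_uIcc (Set.uIoc_subset_uIcc hτ)
      simpa using this
    refine (h τ).trans ?_
    gcongr
  refine (intervalIntegral.norm_integral_le_of_norm_le_const hb).trans (le_of_eq ?_)
  rw [sub_zero, add_mul, mul_assoc, abs_mul_abs_self, ← sq]
  congr 1
  rcases eq_or_ne t 0 with rfl | h0
  · rw [abs_zero, mul_zero, Real.zero_rpow (by linarith)]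
  · rw [← Real.rpow_add_one (abs_pos.2 h0).ne']
    congr 1
    ring

lemma continuous_prim {f : ℝ → ℝ} (hf : Continuous f) : Continuous (prim f) :=
  intervalIntegral.continuous_primitive (fun _ _ => hf.intervalIntegrable _ _) 0

lemma integrable_mul_prim {N : ℕ} {α : ℝ} (hα : 0 < α) (hN : 2 * α < N)
    {V K : EN N → ℝ} {f : ℝ → ℝ} (hV : Continuous V) (hK : Continuous K) (hf : Continuous f)
    (h1 : H1 V K) (h3 : H3 V K) (hf1 : Cf1 f) (hf2 : Cf2 f (critExp N α))
    {u : EN N → ℝ} (hu : memX α V u) : Integrable (fun x => K x * prim f (u x)) := by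
  obtain ⟨i2, iq⟩ := integrable_weight hα hN hV hK h1 h3 hu
  obtain ⟨C, hC0, hC⟩ := exists_growth_bound hf hf1 hf2
  have hum := hu.1
  have hKm := hK.measurable
  have hpm := (continuous_prim hf).measurable
  refine ((i2.const_mul C).add iq).mono' (by fun_prop) (Eventually.of_forall fun x => ?_)
  rw [norm_mul, Real.norm_of_nonneg (h1.2.1 x).le, Real.norm_eq_abs, Pi.add_apply]
  have := mul_le_mul_of_nonneg_left
    (abs_prim_le (by linarith [two_lt_critExp hα hN]) hC0 hC (u x)) (h1.2.1 x).le
  linarith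

lemma measurable_uplus {N : ℕ} {u : EN N → ℝ} (hu : Measurable u) : Measurable (uplus u) :=
  hu.max measurable_const

lemma measurable_uminus {N : ℕ} {u : EN N → ℝ} (hu : Measurable u) : Measurable (uminus u) :=
  hu.min measurable_const

lemma uplus_add_uminus {N : ℕ} (u : EN N → ℝ) (x : EN N) : uplus u x + uminus u x = u x := by
  simp [uplus, uminus, max_add_min]

lemma uplus_mul_uminus {N : ℕ} (u : EN N → ℝ) (x : EN N) : uplus u x * uminus u x = 0 := by
  rcases le_total (u x) 0 with h | h <;> simp [uplus, uminus, h]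

lemma uplus_nonneg {N : ℕ} (u : EN N → ℝ) (x : EN N) : 0 ≤ uplus u x := le_max_right _ _

lemma uminus_nonpos {N : ℕ} (u : EN N → ℝ) (x : EN N) : uminus u x ≤ 0 := min_le_right _ _

lemma cross_identity {N : ℕ} (u : EN N → ℝ) (x y : EN N) :
    (uplus u x - uplus u y) * (uminus u x - uminus u y) =
      -(uplus u x * uminus u y + uminus u x * uplus u y) := by
  linear_combination uplus_mul_uminus u x + uplus_mul_uminus u y

lemma cross_nonneg {N : ℕ} (u : EN N → ℝ) (x y : EN N) :
    0 ≤ (uplus u x - uplus u y) * (uminus u x - uminus u y) := by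
  rw [cross_identity]
  nlinarith [mul_nonneg (uplus_nonneg u x) (neg_nonneg.2 (uminus_nonpos u y)),
    mul_nonneg (uplus_nonneg u y) (neg_nonneg.2 (uminus_nonpos u x))]

lemma sub_eq_uplus_add_uminus {N : ℕ} (u : EN N → ℝ) (x y : EN N) :
    u x - u y = (uplus u x - uplus u y) + (uminus u x - uminus u y) := by
  linear_combination -uplus_add_uminus u x + uplus_add_uminus u y

lemma sq_uplus_sub_le {N : ℕ} (u : EN N → ℝ) (x y : EN N) :
    (uplus u x - uplus u y) ^ 2 ≤ (u x - u y) ^ 2 := by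
  rw [sub_eq_uplus_add_uminus u]
  nlinarith [cross_nonneg u x y, sq_nonneg (uminus u x - uminus u y)]

lemma sq_uminus_sub_le {N : ℕ} (u : EN N → ℝ) (x y : EN N) :
    (uminus u x - uminus u y) ^ 2 ≤ (u x - u y) ^ 2 := by
  rw [sub_eq_uplus_add_uminus u]
  nlinarith [cross_nonneg u x y, sq_nonneg (uplus u x - uplus u y)]

lemma sq_eq_uplus_sq_add_uminus_sq {N : ℕ} (u : EN N → ℝ) (x : EN N) :
    u x ^ 2 = uplus u x ^ 2 + uminus u x ^ 2 := by
  rw [← uplus_add_uminus u x]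
  linear_combination 2 * uplus_mul_uminus u x

lemma memX_of_le {N : ℕ} {α : ℝ} {V u v : EN N → ℝ} (hV : ∀ x, 0 ≤ V x) (hv : Measurable v)
    (hd : ∀ x y, (v x - v y) ^ 2 ≤ (u x - u y) ^ 2) (hs : ∀ x, v x ^ 2 ≤ u x ^ 2)
    (hu : memX α V u) : memX α V v := by
  refine ⟨hv, lt_of_le_of_lt (add_le_add ?_ ?_) hu.2⟩
  · refine lintegral_mono fun p => ENNReal.ofReal_le_ofReal ?_
    exact div_le_div_of_nonneg_right (hd _ _) (by positivity)
  · refine lintegral_mono fun x => ENNReal.ofReal_le_ofReal ?_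
    exact mul_le_mul_of_nonneg_left (hs x) (hV x)

lemma memX_uplus {N : ℕ} {α : ℝ} {V u : EN N → ℝ} (hV : ∀ x, 0 ≤ V x) (hu : memX α V u) :
    memX α V (uplus u) :=
  memX_of_le hV (measurable_uplus hu.1) (sq_uplus_sub_le u)
    (fun x => by nlinarith [sq_eq_uplus_sq_add_uminus_sq u x]) hu

lemma memX_uminus {N : ℕ} {α : ℝ} {V u : EN N → ℝ} (hV : ∀ x, 0 ≤ V x) (hu : memX α V u) :
    memX α V (uminus u) :=
  memX_of_le hV (measurable_uminus hu.1) (sq_uminus_sub_le u)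
    (fun x => by nlinarith [sq_eq_uplus_sq_add_uminus_sq u x]) hu

lemma memX.integrable_gag {N : ℕ} {α : ℝ} {V u : EN N → ℝ} (hu : memX α V u) :
    Integrable (fun p : EN N × EN N =>
      (u p.1 - u p.2) ^ 2 / ‖p.1 - p.2‖ ^ ((N : ℝ) + 2 * α)) := by
  refine ⟨(measurable_gagDensity α hu.1).aestronglyMeasurable, ?_⟩
  rw [hasFiniteIntegral_iff_ofReal (Eventually.of_forall fun p => by positivity)]
  exact (ENNReal.add_lt_top.1 hu.2).1

lemma memX.integrable_potential {N : ℕ} {α : ℝ} {V u : EN N → ℝ} (hVm : Measurable V)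
    (hV : ∀ x, 0 ≤ V x) (hu : memX α V u) : Integrable (fun x => V x * u x ^ 2) := by
  refine ⟨(hVm.mul (hu.1.pow_const 2)).aestronglyMeasurable, ?_⟩
  rw [hasFiniteIntegral_iff_ofReal
    (Eventually.of_forall fun x => mul_nonneg (hV x) (sq_nonneg _))]
  exact (ENNReal.add_lt_top.1 hu.2).2

lemma memX.toReal_normSq {N : ℕ} {α : ℝ} {V u : EN N → ℝ} (hVm : Measurable V)
    (hV : ∀ x, 0 ≤ V x) (hu : memX α V u) :
    (normSq α V u).toReal =
      (∫ p : EN N × EN N, (u p.1 - u p.2) ^ 2 / ‖p.1 - p.2‖ ^ ((N : ℝ) + 2 * α)) +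
        ∫ x, V x * u x ^ 2 := by
  have h := ENNReal.add_lt_top.1 hu.2
  rw [normSq, ENNReal.toReal_add h.1.ne h.2.ne, gagSq,
    integral_eq_lintegral_of_nonneg_ae (Eventually.of_forall fun p => by positivity)
      hu.integrable_gag.1,
    integral_eq_lintegral_of_nonneg_ae
      (Eventually.of_forall fun x => mul_nonneg (hV x) (sq_nonneg _))
      (hu.integrable_potential hVm hV).1]

/-- The interaction of the positive and negative parts is integrable. -/
lemma memX.integrable_cross {N : ℕ} {α : ℝ} {V u : EN N → ℝ} (hu : memX α V u) :
    Integrable (fun p : EN N × EN N =>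
      (uplus u p.1 * uminus u p.2 + uminus u p.1 * uplus u p.2) /
        ‖p.1 - p.2‖ ^ ((N : ℝ) + 2 * α)) := by
  have hp := measurable_uplus hu.1
  have hm := measurable_uminus hu.1
  have hcm : Measurable (fun p : EN N × EN N =>
      (uplus u p.1 * uminus u p.2 + uminus u p.1 * uplus u p.2) /
        ‖p.1 - p.2‖ ^ ((N : ℝ) + 2 * α)) := by fun_prop
  refine hu.integrable_gag.mono' hcm.aestronglyMeasurable (Eventually.of_forall fun p => ?_)
  rw [norm_div, Real.norm_of_nonneg (by positivity : 0 ≤ ‖p.1 - p.2‖ ^ ((N : ℝ) + 2 * α))]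
  refine div_le_div_of_nonneg_right ?_ (by positivity)
  rw [← norm_neg, ← cross_identity, Real.norm_of_nonneg (cross_nonneg u _ _),
    sub_eq_uplus_add_uminus u]
  nlinarith [cross_nonneg u p.1 p.2, sq_nonneg (uplus u p.1 - uplus u p.2),
    sq_nonneg (uminus u p.1 - uminus u p.2)]

lemma prim_eq_uplus_add_uminus {N : ℕ} (f : ℝ → ℝ) (u : EN N → ℝ) (x : EN N) :
    prim f (u x) = prim f (uplus u x) + prim f (uminus u x) := by
  rcases le_total (u x) 0 with h | h <;> simp [uplus, uminus, h, prim]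

end ZeroMass

open ZeroMass
/-- Decomposition of the energy functional `J` and of its derivative along
positive and negative parts. -/
theorem statement11 {N : ℕ} (α : ℝ) (hα : α ∈ Set.Ioo (0 : ℝ) 1) (hN : 2 * α < N)
    (V K : EN N → ℝ) (f : ℝ → ℝ)
    (hV : Continuous V) (hK : Continuous K) (hf : Continuous f)
    (h1 : H1 V K) (h3 : H3 V K)
    (hf1 : Cf1 f) (hf2 : Cf2 f (critExp N α))
    (u : EN N → ℝ) (hu : memX α V u) :
    Jfun α V K f u =
        Jfun α V K f (uplus u) + Jfun α V K f (uminus u) -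
          ∫ p : EN N × EN N,
            (uplus u p.1 * uminus u p.2 + uminus u p.1 * uplus u p.2) /
              ‖p.1 - p.2‖ ^ ((N : ℝ) + 2 * α) ∧
    Jd α V K f u (uplus u) =
        Jd α V K f (uplus u) (uplus u) -
          ∫ p : EN N × EN N,
            (uplus u p.1 * uminus u p.2 + uminus u p.1 * uplus u p.2) /
              ‖p.1 - p.2‖ ^ ((N : ℝ) + 2 * α) := by
  obtain ⟨hα0, -⟩ := hα
  have hV0 : ∀ x, 0 ≤ V x := fun x => (h1.1 x).le
  have hVm := hV.measurable
  have hup := memX_uplus hV0 hu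
  have hum := memX_uminus hV0 hu
  have hcross := hu.integrable_cross
  constructor
  · have hgag : (∫ p : EN N × EN N, (u p.1 - u p.2) ^ 2 / ‖p.1 - p.2‖ ^ ((N : ℝ) + 2 * α)) =
        (∫ p : EN N × EN N,
          (uplus u p.1 - uplus u p.2) ^ 2 / ‖p.1 - p.2‖ ^ ((N : ℝ) + 2 * α)) +
        (∫ p : EN N × EN N,
          (uminus u p.1 - uminus u p.2) ^ 2 / ‖p.1 - p.2‖ ^ ((N : ℝ) + 2 * α)) -
        2 * ∫ p : EN N × EN N, (uplus u p.1 * uminus u p.2 + uminus u p.1 * uplus u p.2) /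
          ‖p.1 - p.2‖ ^ ((N : ℝ) + 2 * α) := by
      rw [← integral_add hup.integrable_gag hum.integrable_gag, ← integral_const_mul]
      refine Eq.trans ?_
        (integral_sub (hup.integrable_gag.add hum.integrable_gag) (hcross.const_mul 2))
      refine integral_congr_ae (Eventually.of_forall fun p => ?_)
      simp only
      rw [sub_eq_uplus_add_uminus u, ← mul_div_assoc, ← add_div, ← sub_div]
      congr 1
      linear_combination 2 * cross_identity u p.1 p.2
    have hpot : (∫ x, V x * u x ^ 2) =
        (∫ x, V x * uplus u x ^ 2) + ∫ x, V x * uminus u x ^ 2 := by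
      rw [← integral_add (hup.integrable_potential hVm hV0) (hum.integrable_potential hVm hV0)]
      simp_rw [sq_eq_uplus_sq_add_uminus_sq u, mul_add]
    have hprim : (∫ x, K x * prim f (u x)) =
        (∫ x, K x * prim f (uplus u x)) + ∫ x, K x * prim f (uminus u x) := by
      rw [← integral_add (integrable_mul_prim hα0 hN hV hK hf h1 h3 hf1 hf2 hup)
        (integrable_mul_prim hα0 hN hV hK hf h1 h3 hf1 hf2 hum)]
      simp_rw [prim_eq_uplus_add_uminus f u, mul_add]
    unfold Jfun
    rw [hu.toReal_normSq hVm hV0, hup.toReal_normSq hVm hV0, hum.toReal_normSq hVm hV0, hgag,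
      hpot, hprim]
    ring
  · have hgag : (∫ p : EN N × EN N, (u p.1 - u p.2) * (uplus u p.1 - uplus u p.2) /
          ‖p.1 - p.2‖ ^ ((N : ℝ) + 2 * α)) =
        (∫ p : EN N × EN N, (uplus u p.1 - uplus u p.2) * (uplus u p.1 - uplus u p.2) /
          ‖p.1 - p.2‖ ^ ((N : ℝ) + 2 * α)) -
        ∫ p : EN N × EN N, (uplus u p.1 * uminus u p.2 + uminus u p.1 * uplus u p.2) /
          ‖p.1 - p.2‖ ^ ((N : ℝ) + 2 * α) := by
      simp_rw [← sq (uplus u _ - uplus u _)]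
      rw [← integral_sub hup.integrable_gag hcross]
      refine integral_congr_ae (Eventually.of_forall fun p => ?_)
      simp only
      rw [sub_eq_uplus_add_uminus u, ← sub_div]
      congr 1
      linear_combination cross_identity u p.1 p.2
    have hpot : ∀ x, V x * u x * uplus u x = V x * uplus u x * uplus u x := fun x => by
      linear_combination V x * uplus_mul_uminus u x - V x * uplus u x * uplus_add_uminus u x
    have hnl : ∀ x, K x * f (u x) * uplus u x = K x * f (uplus u x) * uplus u x := fun x => by
      rcases le_total (u x) 0 with h | h <;> simp [uplus, h]
    unfold Jd
    simp_rw [hgag, hpot, hnl]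
    ring
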